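/- If the toric algebra A_E is consistent, then every arrow of the quiver of sections Q lies in the support of some anticanonical cycle, and hence occurs in a term of the superpotential W. -/

import Mathlib

namespace NCCell
/-- Toric data for a normal affine toric variety `X = Spec k[σ^∨ ∩ M]` of dimension `n`
with a torus-invariant point: the strongly convex, full-dimensional rational cone
`σ ⊆ ℝⁿ` is recorded through the primitive generators `v ρ` of its `d` extremal rays. -/
structure ToricData (n d : ℕ) where
  v : Fin d → Fin n → ℤ
  primitive : ∀ ρ, Finset.univ.gcd (fun i => (v ρ i).natAbs) = 1
  strongly_convex : ∃ u : Fin n → ℤ, ∀ ρ, 0 < ∑ i, u i * v ρ i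
  full_dim : ∀ u : Fin n → ℤ, (∀ ρ, ∑ i, u i * v ρ i = 0) → u = 0
  extremal_rays : ∀ ρ : Fin d, ∃ u : Fin n → ℤ,
    (∑ i, u i * v ρ i = 0) ∧ ∀ ρ', ρ' ≠ ρ → 0 < ∑ i, u i * v ρ' i

namespace ToricData
variable {n d : ℕ} (T : ToricData n d)
/-- The inclusion `M = ℤⁿ → ℤᵈ`, `u ↦ (⟨u, v_ρ⟩)_ρ`, from the exact sequence
`0 → M → ℤᵈ → Cl(X) → 0`. -/
def iota : (Fin n → ℤ) →+ (Fin d → ℤ) where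
  toFun u := fun ρ => ∑ i, u i * T.v ρ i
  map_zero' := by funext ρ; simp
  map_add' u w := by funext ρ; simp [add_mul, Finset.sum_add_distrib]
/-- The sublattice of `ℤᵈ` of principal torus-invariant Weil divisors, i.e. the image
of `M`; the class group `Cl(X)` is the quotient `ℤᵈ ⧸ prin`. -/
def prin : AddSubgroup (Fin d → ℤ) := T.iota.range
/-- `X` is Gorenstein: `(1,…,1)` lies in (the image of) `M`. -/
def Gorenstein : Prop := (fun _ => 1 : Fin d → ℤ) ∈ T.prin
end ToricData

def toInt {d : ℕ} (u : Fin d → ℕ) : Fin d → ℤ := fun ρ => (u ρ : ℤ)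

/-- A collection of distinct rank one reflexive sheaves on `X`, recorded through Weil
divisor representatives `D i` of their divisor classes. -/
structure Collection {n d : ℕ} (T : ToricData n d) (I : Type*) where
  D : I → Fin d → ℤ
  distinct : ∀ i j : I, D i - D j ∈ T.prin → i = j

namespace Collection
section
variable {n d : ℕ} {T : ToricData n d} {I : Type*} (C : Collection T I)
/-- `u ∈ ℕᵈ` is (the divisor of zeroes of) a torus-invariant section of
`Hom(E_i, E_j) = H⁰(X, O_X(D_j - D_i))`, i.e. `u` is effective of class `[D_j - D_i]`. -/
def IsSection (i j : I) (u : Fin d → ℕ) : Prop :=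
  toInt u - (C.D j - C.D i) ∈ T.prin
/-- A torus-invariant section is irreducible if it admits no nontrivial factorisation
through a member of the collection. -/
def IsIrreducible (i j : I) (u : Fin d → ℕ) : Prop :=
  C.IsSection i j u ∧
    ∀ (l : I) (u₁ u₂ : Fin d → ℕ), u = u₁ + u₂ →
      C.IsSection i l u₂ → C.IsSection l j u₁ →
      (l = i ∧ u₂ = 0) ∨ (l = j ∧ u₁ = 0)
/-- An arrow of the quiver of sections `Q` of the collection: an irreducible
torus-invariant section, with its head, tail and labelling divisor `div(a) ∈ ℕᵈ`. -/
structure Arrow where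
  src : I
  tgt : I
  lab : Fin d → ℕ
  irred : C.IsIrreducible src tgt lab
  nontriv : ¬ (src = tgt ∧ lab = 0)
/-- Paths in the quiver of sections (`nil i` is the trivial path `e_i`, and
`cons p a _` is the path `a·p`, i.e. `a` traversed last). -/
inductive Path : I → I → Type _
  | nil (i : I) : Path i i
  | cons {i j : I} (p : Path i j) (a : C.Arrow) (h : a.src = j) : Path i a.tgt
end

section
variable {n d : ℕ} {T : ToricData n d} {I : Type*} {C : Collection T I}
/-- The labelling divisor `div(p) ∈ ℕᵈ` of a path. -/
def Path.lab {i : I} : {j : I} → C.Path i j → (Fin d → ℕ)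
  | _, .nil _ => 0
  | _, .cons p a _ => Path.lab p + a.lab
/-- Composition of paths: `p.comp q` traverses `p` first, then `q`. -/
def Path.comp {i j : I} (p : C.Path i j) : {l : I} → C.Path j l → C.Path i l
  | _, .nil _ => p
  | _, .cons q a h => .cons (Path.comp p q) a h
/-- The arrow traversed last by a path. -/
def Path.lastArrow? {i : I} : {j : I} → C.Path i j → Option (C.Arrow)
  | _, .nil _ => none
  | _, .cons _ a _ => some a
/-- The arrow traversed first by a path. -/
def Path.firstArrow? {i : I} : {j : I} → C.Path i j → Option (C.Arrow)
  | _, .nil _ => none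
  | _, .cons p a _ => some ((Path.firstArrow? p).getD a)
/-- The list of arrows traversed by a path (last traversed first). -/
def Path.arrows {i : I} : {j : I} → C.Path i j → List (C.Arrow)
  | _, .nil _ => []
  | _, .cons p a _ => a :: Path.arrows p

/-- `pp - pm` is one of the generating relations of the ideal of superpotential
relations `J_W`: there is a path `q` such that the derivative `∂_q W` of the
superpotential `W = Σ_{p anticanonical cycle} p` is the sum of precisely the two paths
`pp` and `pm`, and these two paths share neither initial nor final arrow.  (Here
`∂_q W` is the sum of all paths `p` with tail at `h(q)`, head at `t(q)` and labelling
monomial `x^{div p} = Π_ρ x_ρ / x^{div q}`.) -/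
def IsSPRel {i j : I} (pp pm : C.Path i j) : Prop :=
  ∃ q : C.Path j i,
    (∀ ρ, pp.lab ρ + q.lab ρ = 1) ∧ (∀ ρ, pm.lab ρ + q.lab ρ = 1) ∧
    pp ≠ pm ∧
    pp.firstArrow? ≠ pm.firstArrow? ∧ pp.lastArrow? ≠ pm.lastArrow? ∧
    (∀ p : C.Path i j, (∀ ρ, p.lab ρ + q.lab ρ = 1) → p = pp ∨ p = pm)

/-- F-term equivalence of paths: the equivalence relation generated by
`q₂ p₊ q₁ ∼ q₂ p₋ q₁` for superpotential relations `p₊ - p₋ ∈ J_W`.  Two paths are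
identified in the superpotential algebra `A_W = kQ/J_W` iff they are F-term equivalent. -/
inductive FTermEquiv : {i j : I} → C.Path i j → C.Path i j → Prop
  | rel {i j l m : I} {pp pm : C.Path i j} (q₁ : C.Path l i) (q₂ : C.Path j m)
      (h : IsSPRel pp pm) :
      FTermEquiv ((q₁.comp pp).comp q₂) ((q₁.comp pm).comp q₂)
  | refl {i j : I} (p : C.Path i j) : FTermEquiv p p
  | symm {i j : I} {p q : C.Path i j} : FTermEquiv p q → FTermEquiv q p
  | trans {i j : I} {p q r : C.Path i j} : FTermEquiv p q → FTermEquiv q r → FTermEquiv p r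
end

/-- The toric algebra `A_𝓔 = kQ/J_𝓔` is consistent, i.e. `J_𝓔 = J_W`: since (classes of)
paths form bases of both quotient algebras, this says precisely that two paths of `Q`
with the same head and tail are identified in `A_𝓔` (i.e. share the same labelling
divisor) if and only if they are identified in `A_W` (i.e. are F-term equivalent). -/
def Consistent {n d : ℕ} {T : ToricData n d} {I : Type*} (C : Collection T I) : Prop :=
  ∀ (i j : I) (p q : C.Path i j), p.lab = q.lab ↔ FTermEquiv p q

end Collection
end NCCell

namespace NCCell

theorem toInt_add {d : ℕ} (u w : Fin d → ℕ) : toInt (u + w) = toInt u + toInt w := by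
  funext ρ
  simp [toInt]

namespace Collection

variable {n d : ℕ} {T : ToricData n d} {I : Type*} {C : Collection T I}

theorem Path.lab_comp {i j l : I} (p : C.Path i j) (q : C.Path j l) :
    (p.comp q).lab = p.lab + q.lab := by
  induction q with
  | nil => simp [Path.comp, Path.lab]
  | cons q a h ih => simp [Path.comp, Path.lab, ih, add_assoc]

theorem Path.mem_arrows_comp {i j l : I} (p : C.Path i j) (q : C.Path j l) (a : C.Arrow) :
    a ∈ (p.comp q).arrows ↔ a ∈ p.arrows ∨ a ∈ q.arrows := by
  induction q with
  | nil => simp [Path.comp, Path.arrows]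
  | cons q b h ih =>
    simp only [Path.comp, Path.arrows, List.mem_cons, ih]
    tauto

theorem Path.lab_le_of_mem_arrows {i j : I} {p : C.Path i j} {a : C.Arrow}
    (ha : a ∈ p.arrows) : a.lab ≤ p.lab := by
  induction p with
  | nil => simp [Path.arrows] at ha
  | cons p b h ih =>
    simp only [Path.arrows, List.mem_cons] at ha
    rcases ha with rfl | ha
    · exact le_add_of_nonneg_left zero_le
    · exact (ih ha).trans (le_add_of_nonneg_right zero_le)

/-- The path consisting of a single arrow. -/
def Arrow.toPath (a : C.Arrow) : C.Path a.src a.tgt := .cons (.nil a.src) a rfl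

theorem Arrow.lab_toPath (a : C.Arrow) : a.toPath.lab = a.lab := by
  simp [Arrow.toPath, Path.lab]

theorem Arrow.mem_arrows_toPath (a : C.Arrow) : a ∈ a.toPath.arrows := by
  simp [Arrow.toPath, Path.arrows]

/-- The `N`-th power of a cycle. -/
def Path.pow {i : I} (p : C.Path i i) : ℕ → C.Path i i
  | 0 => .nil i
  | N + 1 => (p.pow N).comp p

theorem Path.lab_pow {i : I} (p : C.Path i i) (N : ℕ) : (p.pow N).lab = N • p.lab := by
  induction N with
  | zero => simp [Path.pow, Path.lab]
  | succ N ih => rw [Path.pow, Path.lab_comp, ih, succ_nsmul]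

theorem Path.mem_arrows_of_mem_arrows_pow {i : I} {p : C.Path i i} {N : ℕ} {a : C.Arrow}
    (ha : a ∈ (p.pow N).arrows) : a ∈ p.arrows := by
  induction N with
  | zero => simp [Path.pow, Path.arrows] at ha
  | succ N ih =>
    rw [Path.pow, Path.mem_arrows_comp] at ha
    exact ha.elim ih id

theorem IsSection.eq_of_zero {i j : I} (h : C.IsSection i j 0) : i = j := by
  apply C.distinct
  have h0 : toInt (0 : Fin d → ℕ) = 0 := by
    funext ρ
    simp [toInt]
  rwa [IsSection, h0, zero_sub, neg_sub] at h

/-- Every torus-invariant section is the labelling divisor of a path. -/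
theorem IsSection.exists_path {i j : I} {u : Fin d → ℕ} (h : C.IsSection i j u) :
    ∃ p : C.Path i j, p.lab = u := by
  induction hs : ∑ ρ, u ρ using Nat.strong_induction_on generalizing i j u with
  | _ s ih =>
    have sum_pos : ∀ w : Fin d → ℕ, w ≠ 0 → 0 < ∑ ρ, w ρ := by
      intro w hw
      obtain ⟨ρ, hρ⟩ := Function.ne_iff.mp hw
      exact Finset.sum_pos' (fun _ _ => Nat.zero_le _)
        ⟨ρ, Finset.mem_univ ρ, Nat.pos_of_ne_zero hρ⟩
    by_cases hu : u = 0
    · subst hu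
      obtain rfl := h.eq_of_zero
      exact ⟨.nil i, rfl⟩
    by_cases hirr : C.IsIrreducible i j u
    · exact ⟨Arrow.toPath ⟨i, j, u, hirr, fun hc => hu hc.2⟩, Arrow.lab_toPath _⟩
    simp only [IsIrreducible, not_and, not_forall, not_or] at hirr
    obtain ⟨l, u₁, u₂, rfl, h₂, h₁, hi, hj⟩ := hirr h
    have hu₂ : u₂ ≠ 0 := by
      rintro rfl
      exact hi h₂.eq_of_zero.symm rfl
    have hu₁ : u₁ ≠ 0 := by
      rintro rfl
      exact hj h₁.eq_of_zero rfl
    have hpos₁ := sum_pos u₁ hu₁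
    have hpos₂ := sum_pos u₂ hu₂
    simp only [Pi.add_apply, Finset.sum_add_distrib] at hs
    obtain ⟨p₂, hp₂⟩ := ih (∑ ρ, u₂ ρ) (by omega) h₂ rfl
    obtain ⟨p₁, hp₁⟩ := ih (∑ ρ, u₁ ρ) (by omega) h₁ rfl
    exact ⟨p₂.comp p₁, by rw [Path.lab_comp, hp₁, hp₂, add_comm]⟩

/-- On a Gorenstein variety, a section `u` of `Hom(E_i, E_j)` that divides `∏ x_ρ ^ N` has a
complementary section of `Hom(E_j, E_i)`. -/
theorem IsSection.of_add_eq (hGor : T.Gorenstein) {i j : I} {u w : Fin d → ℕ} {N : ℕ}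
    (h : C.IsSection i j u) (hw : u + w = fun _ => N) : C.IsSection j i w := by
  have hN : toInt u + toInt w = N • (fun _ => 1 : Fin d → ℤ) := by
    rw [← toInt_add, hw]
    funext ρ
    simp [toInt]
  have hmem := T.prin.sub_mem (T.prin.nsmul_mem hGor N) h
  rw [← hN] at hmem
  unfold IsSection
  convert hmem using 1
  abel

/-- An arrow whose label has a multiplicity at least two occurs in no superpotential relation, so
its occurrence in a path is invariant under F-term equivalence. -/
theorem FTermEquiv.mem_arrows_iff {a : C.Arrow} {ρ : Fin d} (ha : 1 < a.lab ρ) {i j : I}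
    {p q : C.Path i j} (h : FTermEquiv p q) : a ∈ p.arrows ↔ a ∈ q.arrows := by
  induction h with
  | @rel i₀ j₀ _ _ _ _ q₁ q₂ h =>
    obtain ⟨q, hp, hm, -⟩ := h
    simp only [Path.mem_arrows_comp]
    have not_mem : ∀ p : C.Path i₀ j₀, (∀ ρ, p.lab ρ + q.lab ρ = 1) → a ∉ p.arrows := by
      intro p hp hmem
      have hle : a.lab ρ ≤ p.lab ρ := Path.lab_le_of_mem_arrows hmem ρ
      have hρ := hp ρ
      omega
    simp [not_mem _ hp, not_mem _ hm]
  | refl => rfl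
  | symm _ ih => exact ih.symm
  | trans _ _ ih₁ ih₂ => exact ih₁.trans ih₂

/-- The labels of the arrows of a consistent collection on a Gorenstein variety are reduced. -/
theorem Consistent.lab_le_one (hGor : T.Gorenstein) (hcon : C.Consistent) (a : C.Arrow)
    (ρ : Fin d) : a.lab ρ ≤ 1 := by
  by_contra! hρ
  have hzero : C.IsSection a.src a.src 0 := by
    have h0 : toInt (0 : Fin d → ℕ) - (C.D a.src - C.D a.src) = 0 := by
      funext ρ
      simp [toInt]
    rw [IsSection, h0]
    exact T.prin.zero_mem
  obtain ⟨c, hc⟩ := (hzero.of_add_eq hGor (w := fun _ => 1) (N := 1) (zero_add _)).exists_path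
  have hN : (a.lab + fun ρ => ∑ τ, a.lab τ - a.lab ρ) = fun _ => ∑ τ, a.lab τ := by
    funext ρ
    exact Nat.add_sub_of_le
      (Finset.single_le_sum (fun _ _ => Nat.zero_le _) (Finset.mem_univ ρ))
  obtain ⟨p, hp⟩ := (a.irred.1.of_add_eq hGor hN).exists_path
  have hlab : (a.toPath.comp p).lab = (c.pow (∑ τ, a.lab τ)).lab := by
    rw [Path.lab_comp, Arrow.lab_toPath, hp, hN, Path.lab_pow, hc]
    funext ρ
    simp
  have hmem := (((hcon _ _ _ _).mp hlab).mem_arrows_iff hρ).mp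
    ((Path.mem_arrows_comp _ _ _).mpr (Or.inl a.mem_arrows_toPath))
  have hle := Path.lab_le_of_mem_arrows (Path.mem_arrows_of_mem_arrows_pow hmem) ρ
  rw [hc] at hle
  exact absurd hle (not_le.mpr hρ)

end Collection
end NCCell

open NCCell Collection

/-- Corollary 3.6: if the toric algebra `A_𝓔` of a collection `𝓔` on
the Gorenstein affine toric variety `X` is consistent, then every arrow of the quiver of
sections `Q` arises in an anticanonical cycle (a cycle `p` with `x^{div p} = Π_ρ x_ρ`),
and hence in a term of the superpotential `W`. -/
theorem consistent_arrow_in_anticanonical_cycle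
    {n d : ℕ} (T : ToricData n d) (hGor : T.Gorenstein) {r : ℕ}
    (C : Collection T (Fin (r + 1))) (hD₀ : C.D 0 = 0)
    (hcon : C.Consistent) :
    ∀ a : C.Arrow, ∃ (i : Fin (r + 1)) (p : C.Path i i),
      (∀ ρ : Fin d, p.lab ρ = 1) ∧ a ∈ p.arrows := by
  intro a
  have hsum : (a.lab + fun ρ => 1 - a.lab ρ) = fun _ => 1 := by
    funext ρ
    exact Nat.add_sub_of_le (hcon.lab_le_one hGor a ρ)
  obtain ⟨q, hq⟩ := (a.irred.1.of_add_eq hGor hsum).exists_path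
  refine ⟨a.src, a.toPath.comp q, fun ρ => ?_, ?_⟩
  · rw [Path.lab_comp, Arrow.lab_toPath, hq, hsum]
  · exact (Path.mem_arrows_comp _ _ _).mpr (Or.inl a.mem_arrows_toPath)
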